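/- In any 3-quasi-Sasakian manifold, the Levi-Civita connection ∇ satisfies, for each α ∈ {1,2,3} and all vector fields X, Y: (∇_X φ_α)Y = (c/2)(η_α(Y) ψ_α² X − g(ψ_α² X, Y) ξ_α). Consequently, for α ≠ β and any vector field X, (∇_{ξ_β} φ_α)X = (c/2)(η_β(X) ξ_α − η_α(X) ξ_β). -/

import Mathlib

/-!
An abstract (Lie–Rinehart style) algebraic model of the differential geometry of
almost contact metric 3-structures: `F` plays the role of the algebra of smooth
functions on a manifold `M` of dimension `4n+3`, and `V` plays the role of the
`F`-module of smooth vector fields, acting on `F` by derivations and carrying a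
Lie bracket, a Riemannian metric `g`, and three almost contact metric structures
`(φ_α, ξ_α, η_α, g)`.
-/

noncomputable section

namespace QS3

/-- Cyclic (= even) permutations of `{0,1,2}`, modelling even permutations of `{1,2,3}`. -/
def Cyclic (a b c : Fin 3) : Prop :=
  (a, b, c) = (0, 1, 2) ∨ (a, b, c) = (1, 2, 0) ∨ (a, b, c) = (2, 0, 1)

/-- The algebraic model of the smooth structure of a manifold: an `ℝ`-algebra `F`
of smooth functions and an `F`-module `V` of vector fields acting on `F` by
derivations and carrying the Lie bracket of vector fields. -/
class SmoothSetting (F : Type) (V : Type) [CommRing F] [Algebra ℝ F]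
    [AddCommGroup V] [Module F V] where
  act : V → F → F
  bracket : V → V → V
  act_add : ∀ (X : V) (f₁ f₂ : F), act X (f₁ + f₂) = act X f₁ + act X f₂
  act_mul : ∀ (X : V) (f₁ f₂ : F), act X (f₁ * f₂) = act X f₁ * f₂ + f₁ * act X f₂
  act_const : ∀ (X : V) (r : ℝ), act X (algebraMap ℝ F r) = 0
  act_addLeft : ∀ (X Y : V) (f : F), act (X + Y) f = act X f + act Y f
  act_smulLeft : ∀ (f : F) (X : V) (h : F), act (f • X) h = f * act X h
  bracket_antisymm : ∀ X Y : V, bracket X Y = -bracket Y X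
  bracket_addLeft : ∀ X Y Z : V, bracket (X + Y) Z = bracket X Z + bracket Y Z
  bracket_act : ∀ (X Y : V) (f : F),
    act (bracket X Y) f = act X (act Y f) - act Y (act X f)
  bracket_smulRight : ∀ (X : V) (f : F) (Y : V),
    bracket X (f • Y) = f • bracket X Y + act X f • Y
  jacobi : ∀ X Y Z : V,
    bracket X (bracket Y Z) + bracket Y (bracket Z X) + bracket Z (bracket X Y) = 0

section d

variable (F V : Type) [CommRing F] [Algebra ℝ F] [AddCommGroup V] [Module F V]
  [SmoothSetting F V]

/-- The action of a vector field on a function (directional derivative). -/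
def der (X : V) (f : F) : F := SmoothSetting.act X f

/-- The Lie bracket of vector fields. -/
def lie (X Y : V) : V := SmoothSetting.bracket F X Y

/-- Exterior differential of a 1-form (with the `1/2` normalization convention,
so that `2 dθ(X,Y) = X θ(Y) - Y θ(X) - θ([X,Y])`). -/
def dOne (θ : V → F) (X Y : V) : F :=
  (2 : ℝ)⁻¹ • (der F V X (θ Y) - der F V Y (θ X) - θ (lie F V X Y))

/-- Exterior differential of a 2-form (with the `1/3` normalization convention). -/
def dTwo (ω : V → V → F) (X Y Z : V) : F :=
  (3 : ℝ)⁻¹ • (der F V X (ω Y Z) + der F V Y (ω Z X) + der F V Z (ω X Y)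
    - ω (lie F V X Y) Z - ω (lie F V Y Z) X - ω (lie F V Z X) Y)

end d

/-- An almost contact metric 3-structure on a manifold of dimension `4n+3`:
three almost contact metric structures `(φ_α, ξ_α, η_α, g)` satisfying the
quaternionic-type relations, together with a (local) orthonormal frame. -/
class ACM3 (F V : Type) [CommRing F] [Algebra ℝ F] [AddCommGroup V] [Module F V]
    [SmoothSetting F V] where
  n : ℕ
  g : V → V → F
  phi : Fin 3 → V → V
  xi : Fin 3 → V
  eta : Fin 3 → V → F
  g_symm : ∀ X Y, g X Y = g Y X
  g_addLeft : ∀ X Y Z, g (X + Y) Z = g X Z + g Y Z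
  g_smulLeft : ∀ (f : F) (X Y : V), g (f • X) Y = f * g X Y
  g_nondeg : ∀ X, (∀ Y, g X Y = 0) → X = 0
  phi_add : ∀ α (X Y : V), phi α (X + Y) = phi α X + phi α Y
  phi_smul : ∀ α (f : F) (X : V), phi α (f • X) = f • phi α X
  eta_eq : ∀ α X, eta α X = g X (xi α)
  acm_sq : ∀ α X, phi α (phi α X) = -X + eta α X • xi α
  eta_xi : ∀ α, eta α (xi α) = 1
  compat : ∀ α X Y, g (phi α X) (phi α Y) = g X Y - eta α X * eta α Y
  quat_phi : ∀ a b c, Cyclic a b c → ∀ X, phi c X = phi a (phi b X) - eta b X • xi a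
  quat_phi' : ∀ a b c, Cyclic a b c → ∀ X, phi c X = -(phi b (phi a X)) + eta a X • xi b
  quat_xi : ∀ a b c, Cyclic a b c → xi c = phi a (xi b)
  quat_xi' : ∀ a b c, Cyclic a b c → xi c = -(phi b (xi a))
  quat_eta : ∀ a b c, Cyclic a b c → ∀ X, eta c X = eta a (phi b X)
  quat_eta' : ∀ a b c, Cyclic a b c → ∀ X, eta c X = -(eta b (phi a X))
  frame : Fin (4 * n + 3) → V
  frame_orth : ∀ i j, g (frame i) (frame j) = if i = j then 1 else 0
  frame_span : ∀ X : V, X = ∑ i, g X (frame i) • frame i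

section acm

variable (F V : Type) [CommRing F] [Algebra ℝ F] [AddCommGroup V] [Module F V]
  [SmoothSetting F V] [ACM3 F V]

/-- The integer `n` (the manifold has dimension `4n+3`). -/
def dimn : ℕ := ACM3.n F V

/-- The Riemannian metric. -/
def gm (X Y : V) : F := ACM3.g X Y

/-- The structure tensors `φ_α`. -/
def ph (α : Fin 3) (X : V) : V := ACM3.phi F α X

/-- The Reeb vector fields `ξ_α`. -/
def rxi (α : Fin 3) : V := ACM3.xi F α

/-- The 1-forms `η_α`. -/
def et (α : Fin 3) (X : V) : F := ACM3.eta α X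

/-- The orthonormal frame. -/
def fr (i : Fin (4 * dimn F V + 3)) : V := ACM3.frame i

/-- The fundamental 2-form `Φ_α(X,Y) = g(X, φ_α Y)`. -/
def Phi (α : Fin 3) (X Y : V) : F := gm F V X (ph F V α Y)

/-- The Nijenhuis torsion `[φ_α, φ_α]` of `φ_α`. -/
def Nij (α : Fin 3) (X Y : V) : V :=
  ph F V α (ph F V α (lie F V X Y)) + lie F V (ph F V α X) (ph F V α Y)
    - ph F V α (lie F V (ph F V α X) Y) - ph F V α (lie F V X (ph F V α Y))

/-- The normality tensor `N⁽¹⁾_α = [φ_α, φ_α] + 2 dη_α ⊗ ξ_α`. -/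
def NOne (α : Fin 3) (X Y : V) : V :=
  Nij F V α X Y + ((2 : ℝ) • dOne F V (et F V α) X Y) • rxi F V α

/-- The structure `(φ_α, ξ_α, η_α)` is normal. -/
def IsNormal (α : Fin 3) : Prop := ∀ X Y, NOne F V α X Y = 0

/-- A 2-form is closed. -/
def IsClosedTwo (ω : V → V → F) : Prop := ∀ X Y Z, dTwo F V ω X Y Z = 0

/-- The structure `(φ_α, ξ_α, η_α, g)` is quasi-Sasakian: normal with closed
fundamental 2-form. -/
def IsQuasiSasakian (α : Fin 3) : Prop :=
  IsNormal F V α ∧ IsClosedTwo F V (Phi F V α)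

/-- `M` is 3-cosymplectic: each structure is normal with `dη_α = 0` and `dΦ_α = 0`. -/
def ThreeCosymplectic : Prop :=
  ∀ α, IsNormal F V α ∧ (∀ X Y, dOne F V (et F V α) X Y = 0) ∧
    IsClosedTwo F V (Phi F V α)

/-- `M` is 3-α-Sasakian with constant `a ≠ 0`: each structure is normal (an
`α`-Sasakian structure) and `dη_δ = a Φ_δ`. -/
def Is3AlphaSasakianWith (a : ℝ) : Prop :=
  a ≠ 0 ∧ (∀ δ, IsNormal F V δ) ∧
    ∀ (δ : Fin 3) (X Y : V), dOne F V (et F V δ) X Y = algebraMap ℝ F a * Phi F V δ X Y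

/-- A vector field is horizontal: it lies in `H = ∩_α ker η_α`. -/
def Horiz (X : V) : Prop := ∀ α, et F V α X = 0

/-- A vector field is vertical: it lies in `V = ⟨ξ₁, ξ₂, ξ₃⟩`. -/
def InVert (X : V) : Prop :=
  ∃ p q r : F, X = p • rxi F V 0 + q • rxi F V 1 + r • rxi F V 2

/-- The distribution `E^{4m} = {X ∈ H : i_X dη_α = 0}`. -/
def InE4m (X : V) : Prop :=
  Horiz F V X ∧ ∀ (α : Fin 3) (Y : V), dOne F V (et F V α) X Y = 0

/-- The distribution `E^{4l}`: the orthogonal complement of `E^{4m}` in `H`. -/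
def InE4l (X : V) : Prop :=
  Horiz F V X ∧ ∀ Y, InE4m F V Y → gm F V X Y = 0

/-- The distribution `E^{4l+3} = E^{4l} ⊕ V`. -/
def InE4l3 (X : V) : Prop :=
  ∃ Y Z, InE4l F V Y ∧ InVert F V Z ∧ X = Y + Z

/-- The distribution `E^{4m+3} = E^{4m} ⊕ V`. -/
def InE4m3 (X : V) : Prop :=
  ∃ Y Z, InE4m F V Y ∧ InVert F V Z ∧ X = Y + Z

/-- The horizontal component `X_H = X - ∑_α η_α(X) ξ_α` of a vector field. -/
def horComp (X : V) : V := X - ∑ α : Fin 3, et F V α X • rxi F V α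

/-- A vector field is basic with respect to the foliation defined by `E^{4m}`. -/
def BasicE4m (X : V) : Prop :=
  InE4l3 F V X ∧ ∀ W, InE4m F V W → InE4m F V (lie F V W X)

/-- A vector field is basic with respect to the foliation defined by `E^{4l+3}`. -/
def BasicE4l3 (X : V) : Prop :=
  InE4m F V X ∧ ∀ W, InE4l3 F V W → InE4l3 F V (lie F V W X)

end acm

/-- A 3-quasi-Sasakian structure: each of the three almost contact metric
structures is quasi-Sasakian.  We also record, as part of the structure, the
standard structural facts established for such manifolds in the literature
(Cappelletti Montano–De Nicola–Dileo): the Reeb commutation relations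
`[ξ_α, ξ_β] = c ξ_γ`, the splitting `H = E^{4l} ⊕ E^{4m}` (constancy of the
rank), the `φ_α`-invariance of both distributions, and the tensors `ψ_α`
(equal to `φ_α` on `E^{4l+3}` and vanishing on `E^{4m}` when the rank is
`4l+3`, i.e. `c ≠ 0`; equal to `φ_α` on `E^{4l}` and vanishing on `E^{4m+3}`
when the rank is `4l+1`, i.e. `c = 0`). -/
class ThreeQS (F V : Type) [CommRing F] [Algebra ℝ F] [AddCommGroup V] [Module F V]
    [SmoothSetting F V] [ACM3 F V] where
  qs : ∀ α, IsQuasiSasakian F V α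
  c : ℝ
  reeb_bracket : ∀ a b c', Cyclic a b c' →
    lie F V (rxi F V a) (rxi F V b) = algebraMap ℝ F c • rxi F V c'
  horiz_split : ∀ X, Horiz F V X → ∃ Y Z, InE4l F V Y ∧ InE4m F V Z ∧ X = Y + Z
  phi_E4l : ∀ α X, InE4l F V X → InE4l F V (ph F V α X)
  phi_E4m : ∀ α X, InE4m F V X → InE4m F V (ph F V α X)
  psi : Fin 3 → V → V
  psi_add : ∀ α (X Y : V), psi α (X + Y) = psi α X + psi α Y
  psi_smul : ∀ α (f : F) (X : V), psi α (f • X) = f • psi α X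
  psi_E4l : ∀ α X, InE4l F V X → psi α X = ph F V α X
  psi_E4m : ∀ α X, InE4m F V X → psi α X = 0
  psi_vert_of_ne : c ≠ 0 → ∀ α β, psi α (rxi F V β) = ph F V α (rxi F V β)
  psi_vert_of_eq : c = 0 → ∀ α β, psi α (rxi F V β) = 0

section tqs

variable (F V : Type) [CommRing F] [Algebra ℝ F] [AddCommGroup V] [Module F V]
  [SmoothSetting F V] [ACM3 F V] [ThreeQS F V]

/-- The constant `c` with `[ξ_α, ξ_β] = c ξ_γ`. -/
def cc : ℝ := ThreeQS.c F V

/-- The tensors `ψ_α`. -/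
def psiT (α : Fin 3) (X : V) : V := ThreeQS.psi F α X

/-- The tensors `θ_α = φ_α - ψ_α`. -/
def thetaT (α : Fin 3) (X : V) : V := ph F V α X - psiT F V α X

/-- The 2-forms `Θ_α(X,Y) = g(X, θ_α Y)`. -/
def ThetaForm (α : Fin 3) (X Y : V) : F := gm F V X (thetaT F V α Y)

end tqs

/-- The 3-quasi-Sasakian manifold has rank `4l+3`: the constant `c` is nonzero
and the orthonormal frame is adapted to the splitting
`TM = E^{4l} ⊕ E^{4m} ⊕ ⟨ξ₁,ξ₂,ξ₃⟩` with `dim E^{4l} = 4l` (hence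
`dim E^{4m} = 4m`, `m = n - l`, and the rank of the `η_α` is `4l+3`). -/
class HasRank (F V : Type) [CommRing F] [Algebra ℝ F] [AddCommGroup V] [Module F V]
    [SmoothSetting F V] [ACM3 F V] [ThreeQS F V] (l : ℕ) : Prop where
  c_ne : cc F V ≠ 0
  l_le : l ≤ dimn F V
  frame_E4l : ∀ i : Fin (4 * dimn F V + 3), i.val < 4 * l → InE4l F V (fr F V i)
  frame_E4m : ∀ i : Fin (4 * dimn F V + 3), 4 * l ≤ i.val → i.val < 4 * dimn F V →
    InE4m F V (fr F V i)
  frame_xi : ∀ (i : Fin (4 * dimn F V + 3)) (a : Fin 3),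
    i.val = 4 * dimn F V + a.val → fr F V i = rxi F V a

/-- The Levi-Civita connection of `g`: the unique torsion-free metric connection. -/
class LeviCivita (F V : Type) [CommRing F] [Algebra ℝ F] [AddCommGroup V] [Module F V]
    [SmoothSetting F V] [ACM3 F V] where
  nabla : V → V → V
  nabla_addLeft : ∀ X Y Z : V, nabla (X + Y) Z = nabla X Z + nabla Y Z
  nabla_smulLeft : ∀ (f : F) (X Y : V), nabla (f • X) Y = f • nabla X Y
  nabla_addRight : ∀ X Y Z : V, nabla X (Y + Z) = nabla X Y + nabla X Z
  nabla_leibniz : ∀ (X : V) (f : F) (Y : V),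
    nabla X (f • Y) = der F V X f • Y + f • nabla X Y
  nabla_metric : ∀ X Y Z : V,
    der F V X (gm F V Y Z) = gm F V (nabla X Y) Z + gm F V Y (nabla X Z)
  nabla_torsionFree : ∀ X Y : V, nabla X Y - nabla Y X = lie F V X Y

section curv

variable (F V : Type) [CommRing F] [Algebra ℝ F] [AddCommGroup V] [Module F V]
  [SmoothSetting F V] [ACM3 F V] [LeviCivita F V]

/-- The Levi-Civita covariant derivative `∇_X Y`. -/
def nab (X Y : V) : V := LeviCivita.nabla F X Y

/-- The Riemannian curvature `R(X,Y)Z = ∇_X ∇_Y Z - ∇_Y ∇_X Z - ∇_{[X,Y]} Z`. -/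
def Rcurv (X Y Z : V) : V :=
  nab F V X (nab F V Y Z) - nab F V Y (nab F V X Z) - nab F V (lie F V X Y) Z

/-- The Ricci tensor `Ric(X,Y) = ∑_i g(R(e_i, X)Y, e_i)`. -/
def Ric (X Y : V) : F :=
  ∑ i, gm F V (Rcurv F V (fr F V i) X Y) (fr F V i)

/-- The scalar curvature. -/
def Scal : F := ∑ i, Ric F V (fr F V i) (fr F V i)

/-- `M` is Einstein: `Ric = a g` for a constant `a`. -/
def Einstein : Prop :=
  ∃ a : ℝ, ∀ X Y, Ric F V X Y = algebraMap ℝ F a * gm F V X Y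

/-- `M` is η-Einstein: `Ric = a g + b ∑_α η_α ⊗ η_α` for constants `a, b`. -/
def EtaEinstein : Prop :=
  ∃ a b : ℝ, ∀ X Y, Ric F V X Y
    = algebraMap ℝ F a * gm F V X Y
      + algebraMap ℝ F b * ∑ α : Fin 3, et F V α X * et F V α Y

end curv

/-- A (Koszul) linear connection on vector fields. -/
def IsConnection (F V : Type) [CommRing F] [Algebra ℝ F] [AddCommGroup V] [Module F V]
    [SmoothSetting F V] (D : V → V → V) : Prop :=
  (∀ X Y Z : V, D (X + Y) Z = D X Z + D Y Z) ∧
  (∀ (f : F) (X Y : V), D (f • X) Y = f • D X Y) ∧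
  (∀ X Y Z : V, D X (Y + Z) = D X Y + D X Z) ∧
  (∀ (X : V) (f : F) (Y : V), D X (f • Y) = der F V X f • Y + f • D X Y)

end QS3

namespace QS3

section basic

variable (F V : Type) [CommRing F] [Algebra ℝ F] [AddCommGroup V] [Module F V]
  [SmoothSetting F V]

theorem two_smul_cancel {F V : Type} [CommRing F] [Algebra ℝ F] [AddCommGroup V] [Module F V]
    {X Y : V} (h : (2 : F) • X = (2 : F) • Y) : X = Y := by
  have h2 : algebraMap ℝ F 2⁻¹ * 2 = 1 := by
    rw [← map_ofNat (algebraMap ℝ F) 2, ← map_mul]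
    norm_num
  simpa [smul_smul, h2] using congrArg (algebraMap ℝ F 2⁻¹ • ·) h

theorem two_mul_cancel {F : Type} [CommRing F] [Algebra ℝ F] {x y : F}
    (h : 2 * x = 2 * y) : x = y :=
  two_smul_cancel (F := F) h

theorem two_smul_inv_two {F : Type} [CommRing F] [Algebra ℝ F] (x : F) :
    (2 : ℝ) • (2 : ℝ)⁻¹ • x = x := by
  rw [smul_smul]; norm_num

theorem der_add (X : V) (f h : F) : der F V X (f + h) = der F V X f + der F V X h :=
  SmoothSetting.act_add X f h

theorem der_algebraMap (X : V) (r : ℝ) : der F V X (algebraMap ℝ F r) = 0 :=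
  SmoothSetting.act_const X r

theorem der_mul (X : V) (f h : F) :
    der F V X (f * h) = der F V X f * h + f * der F V X h :=
  SmoothSetting.act_mul X f h

theorem der_two_mul (X : V) (f : F) : der F V X (2 * f) = 2 * der F V X f := by
  rw [two_mul, der_add, two_mul]

theorem der_zero (X : V) : der F V X (0 : F) = 0 := by
  simpa using der_algebraMap F V X 0

theorem der_one (X : V) : der F V X (1 : F) = 0 := by
  simpa using der_algebraMap F V X 1

theorem der_neg (X : V) (f : F) : der F V X (-f) = -der F V X f := by
  have h := der_add F V X f (-f)
  rw [add_neg_cancel, der_zero] at h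
  linear_combination -h

theorem der_sub (X : V) (f h : F) : der F V X (f - h) = der F V X f - der F V X h := by
  rw [sub_eq_add_neg, der_add, der_neg, sub_eq_add_neg]

theorem der_lie (X Y : V) (f : F) :
    der F V (lie F V X Y) f = der F V X (der F V Y f) - der F V Y (der F V X f) :=
  SmoothSetting.bracket_act X Y f

theorem lie_antisymm (X Y : V) : lie F V X Y = -lie F V Y X :=
  SmoothSetting.bracket_antisymm X Y

theorem lie_jacobi (X Y Z : V) :
    lie F V X (lie F V Y Z) + lie F V Y (lie F V Z X) + lie F V Z (lie F V X Y) = 0 :=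
  SmoothSetting.jacobi X Y Z

variable [ACM3 F V]

theorem gm_symm (X Y : V) : gm F V X Y = gm F V Y X := ACM3.g_symm X Y

theorem gm_add_left (X Y Z : V) : gm F V (X + Y) Z = gm F V X Z + gm F V Y Z :=
  ACM3.g_addLeft X Y Z

theorem gm_smul_left (f : F) (X Y : V) : gm F V (f • X) Y = f * gm F V X Y :=
  ACM3.g_smulLeft f X Y

theorem gm_neg_left (X Y : V) : gm F V (-X) Y = -gm F V X Y := by
  simpa using gm_smul_left F V (-1) X Y

theorem gm_sub_left (X Y Z : V) : gm F V (X - Y) Z = gm F V X Z - gm F V Y Z := by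
  rw [sub_eq_add_neg, gm_add_left, gm_neg_left, sub_eq_add_neg]

theorem gm_zero_left (X : V) : gm F V 0 X = 0 := by
  simpa using gm_smul_left F V 0 0 X

theorem gm_add_right (X Y Z : V) : gm F V X (Y + Z) = gm F V X Y + gm F V X Z := by
  simp only [gm_symm F V X, gm_add_left]

theorem gm_smul_right (f : F) (X Y : V) : gm F V X (f • Y) = f * gm F V X Y := by
  simp only [gm_symm F V X, gm_smul_left]

theorem gm_neg_right (X Y : V) : gm F V X (-Y) = -gm F V X Y := by
  simp only [gm_symm F V X, gm_neg_left]

theorem gm_zero_right (X : V) : gm F V X 0 = 0 := by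
  rw [gm_symm, gm_zero_left]

variable {F V} in
theorem gm_ext {X Y : V} (h : ∀ W, gm F V X W = gm F V Y W) : X = Y :=
  sub_eq_zero.1 <| ACM3.g_nondeg (F := F) _ fun W => by
    have := gm_sub_left F V X Y W
    rw [h W, sub_self] at this
    exact this

theorem ph_add (α : Fin 3) (X Y : V) : ph F V α (X + Y) = ph F V α X + ph F V α Y :=
  ACM3.phi_add α X Y

theorem ph_smul (α : Fin 3) (f : F) (X : V) : ph F V α (f • X) = f • ph F V α X :=
  ACM3.phi_smul α f X

theorem ph_neg (α : Fin 3) (X : V) : ph F V α (-X) = -ph F V α X := by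
  simpa using ph_smul F V α (-1) X

theorem ph_sub (α : Fin 3) (X Y : V) : ph F V α (X - Y) = ph F V α X - ph F V α Y := by
  rw [sub_eq_add_neg, ph_add, ph_neg, sub_eq_add_neg]

theorem ph_zero (α : Fin 3) : ph F V α 0 = 0 := by
  simpa using ph_smul F V α 0 0

theorem et_eq (α : Fin 3) (X : V) : et F V α X = gm F V X (rxi F V α) := ACM3.eta_eq α X

theorem et_add (α : Fin 3) (X Y : V) : et F V α (X + Y) = et F V α X + et F V α Y := by
  simp only [et_eq, gm_add_left]

theorem et_smul (α : Fin 3) (f : F) (X : V) : et F V α (f • X) = f * et F V α X := by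
  simp only [et_eq, gm_smul_left]

theorem et_neg (α : Fin 3) (X : V) : et F V α (-X) = -et F V α X := by
  simp only [et_eq, gm_neg_left]

theorem et_sub (α : Fin 3) (X Y : V) : et F V α (X - Y) = et F V α X - et F V α Y := by
  simp only [et_eq, gm_sub_left]

theorem et_xi (α : Fin 3) : et F V α (rxi F V α) = 1 := ACM3.eta_xi α

theorem et_zero (α : Fin 3) : et F V α 0 = 0 := by
  rw [et_eq, gm_zero_left]

theorem gm_xi_right (α : Fin 3) (X : V) : gm F V X (rxi F V α) = et F V α X :=
  (et_eq F V α X).symm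

theorem gm_xi_left (α : Fin 3) (X : V) : gm F V (rxi F V α) X = et F V α X := by
  rw [gm_symm, gm_xi_right]

theorem ph_ph (α : Fin 3) (X : V) :
    ph F V α (ph F V α X) = -X + et F V α X • rxi F V α := ACM3.acm_sq α X

theorem Cyclic.rotate {a b c : Fin 3} (h : Cyclic a b c) : Cyclic b c a := by
  rcases h with h | h | h <;> simp only [Prod.mk.injEq] at h <;>
    obtain ⟨rfl, rfl, rfl⟩ := h <;> simp [Cyclic]

theorem Cyclic.ne {a b c : Fin 3} (h : Cyclic a b c) : a ≠ b := by
  unfold Cyclic at h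
  decide +revert

theorem exists_cyclic (a : Fin 3) : ∃ b c, Cyclic a b c := by
  fin_cases a
  · exact ⟨1, 2, by simp [Cyclic]⟩
  · exact ⟨2, 0, by simp [Cyclic]⟩
  · exact ⟨0, 1, by simp [Cyclic]⟩

theorem cyclic_cases {a b : Fin 3} (h : a ≠ b) : ∃ c, Cyclic a b c ∨ Cyclic b a c := by
  unfold Cyclic
  decide +revert

section cyclic

variable {a b c : Fin 3}

theorem ph_eq_ph_ph (h : Cyclic a b c) (X : V) : ph F V c X = ph F V a (ph F V b X) - et F V b X • rxi F V a :=
  ACM3.quat_phi a b c h X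

theorem ph_eq_neg_ph_ph (h : Cyclic a b c) (X : V) :
    ph F V c X = -ph F V b (ph F V a X) + et F V a X • rxi F V b :=
  ACM3.quat_phi' a b c h X

theorem ph_xi_next (h : Cyclic a b c) : ph F V a (rxi F V b) = rxi F V c := (ACM3.quat_xi a b c h).symm

theorem ph_xi_prev (h : Cyclic a b c) : ph F V b (rxi F V a) = -rxi F V c := by
  rw [show rxi F V c = -ph F V b (rxi F V a) from ACM3.quat_xi' a b c h, neg_neg]

theorem et_ph_next (h : Cyclic a b c) (X : V) : et F V a (ph F V b X) = et F V c X :=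
  (ACM3.quat_eta a b c h X).symm

theorem et_ph_prev (h : Cyclic a b c) (X : V) : et F V b (ph F V a X) = -et F V c X := by
  rw [show et F V c X = -et F V b (ph F V a X) from ACM3.quat_eta' a b c h X, neg_neg]

theorem et_xi_next (h : Cyclic a b c) : et F V b (rxi F V c) = 0 := by
  apply two_mul_cancel
  have h1 := et_ph_prev F V h (rxi F V b)
  rw [ph_xi_next F V h] at h1
  have h2 : et F V c (rxi F V b) = et F V b (rxi F V c) := by
    rw [et_eq, gm_xi_left]
  linear_combination h1 - h2

end cyclic

theorem et_xi_of_ne {a b : Fin 3} (h : a ≠ b) : et F V a (rxi F V b) = 0 := by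
  obtain ⟨c, hc | hc⟩ := cyclic_cases h
  · exact et_xi_next F V hc.rotate.rotate
  · rw [et_eq, gm_xi_left]
    exact et_xi_next F V hc.rotate.rotate

theorem ph_xi (a : Fin 3) : ph F V a (rxi F V a) = 0 := by
  obtain ⟨b, c, h⟩ := exists_cyclic a
  have hb : ph F V a (rxi F V a) = ph F V b (rxi F V b) := by
    have h1 := ph_eq_neg_ph_ph F V h.rotate.rotate (rxi F V b)
    rw [ph_xi_prev F V h.rotate, ph_neg, neg_neg] at h1
    have h2 : et F V c (rxi F V b) = 0 := by
      rw [et_eq, gm_xi_left, et_xi_next F V h]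
    rw [h1, h2, zero_smul, add_zero]
  have key : ∀ d : Fin 3, ph F V d (rxi F V d) = et F V d (ph F V d (rxi F V d)) • rxi F V d := by
    intro d
    have h1 := ph_ph F V d (ph F V d (rxi F V d))
    rw [ph_ph F V d (rxi F V d), et_xi, one_smul, neg_add_cancel, ph_zero] at h1
    exact (neg_add_eq_zero.1 h1.symm)
  have hz : et F V a (ph F V a (rxi F V a)) = 0 := by
    have h1 := key b
    rw [← hb] at h1
    have hab : et F V a (rxi F V b) = 0 := et_xi_next F V h.rotate.rotate
    rw [h1, et_smul, hab, mul_zero]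
  rw [key a, hz, zero_smul]

theorem et_ph (α : Fin 3) (X : V) : et F V α (ph F V α X) = 0 := by
  have h1 := ph_ph F V α (ph F V α X)
  rw [ph_ph F V α X, ph_add, ph_smul, ph_xi, smul_zero, add_zero, ph_neg,
    left_eq_add] at h1
  simpa [et_smul, et_xi, et_zero] using congrArg (et F V α) h1

theorem gm_ph (α : Fin 3) (X Y : V) : gm F V (ph F V α X) Y = -gm F V X (ph F V α Y) := by
  have h : gm F V (ph F V α X) (ph F V α (ph F V α Y))
      = gm F V X (ph F V α Y) - et F V α X * et F V α (ph F V α Y) :=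
    ACM3.compat α X (ph F V α Y)
  rw [ph_ph, et_ph, gm_add_right, gm_neg_right, gm_smul_right, gm_xi_right, et_ph] at h
  linear_combination -h

variable {F V} in
/-- The identity `d(dη_α) = 0`. -/
theorem dEta_closed (α : Fin 3) (X Y Z : V) (w : V → V → F)
    (hw : ∀ A B, w A B = der F V A (et F V α B) - der F V B (et F V α A)
      - et F V α (lie F V A B)) :
    der F V X (w Y Z) + der F V Y (w Z X) + der F V Z (w X Y)
      - w (lie F V X Y) Z - w (lie F V Y Z) X - w (lie F V Z X) Y = 0 := by
  have h := congrArg (et F V α) (lie_jacobi F V X Y Z)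
  rw [et_add, et_add, et_zero] at h
  simp only [hw, der_sub, der_lie, lie_antisymm F V (lie F V _ _), et_neg]
  linear_combination -h

end basic

section connection

variable (F V : Type) [CommRing F] [Algebra ℝ F] [AddCommGroup V] [Module F V]
  [SmoothSetting F V] [ACM3 F V] [LeviCivita F V]

theorem nab_add_left (X Y Z : V) : nab F V (X + Y) Z = nab F V X Z + nab F V Y Z :=
  LeviCivita.nabla_addLeft X Y Z

theorem nab_smul_left (f : F) (X Y : V) : nab F V (f • X) Y = f • nab F V X Y :=
  LeviCivita.nabla_smulLeft f X Y

theorem nab_neg_left (X Y : V) : nab F V (-X) Y = -nab F V X Y := by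
  simpa using nab_smul_left F V (-1) X Y

theorem nab_sub_left (X Y Z : V) : nab F V (X - Y) Z = nab F V X Z - nab F V Y Z := by
  rw [sub_eq_add_neg, nab_add_left, nab_neg_left, sub_eq_add_neg]

theorem nab_add_right (X Y Z : V) : nab F V X (Y + Z) = nab F V X Y + nab F V X Z :=
  LeviCivita.nabla_addRight X Y Z

theorem nab_leibniz (X : V) (f : F) (Y : V) :
    nab F V X (f • Y) = der F V X f • Y + f • nab F V X Y :=
  LeviCivita.nabla_leibniz X f Y

theorem nab_neg_right (X Y : V) : nab F V X (-Y) = -nab F V X Y := by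
  have h := nab_leibniz F V X (-1) Y
  rw [der_neg, der_one] at h
  simpa using h

theorem der_gm (X Y Z : V) :
    der F V X (gm F V Y Z) = gm F V (nab F V X Y) Z + gm F V Y (nab F V X Z) :=
  LeviCivita.nabla_metric X Y Z

theorem lie_eq (X Y : V) : lie F V X Y = nab F V X Y - nab F V Y X :=
  (LeviCivita.nabla_torsionFree X Y).symm

theorem der_et (α : Fin 3) (X Y : V) :
    der F V X (et F V α Y) = et F V α (nab F V X Y) + gm F V (nab F V X (rxi F V α)) Y := by
  rw [et_eq, der_gm, ← et_eq, gm_symm F V Y]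

theorem et_nab_xi (α : Fin 3) (X : V) : et F V α (nab F V X (rxi F V α)) = 0 := by
  have h := der_et F V α X (rxi F V α)
  rw [et_xi, der_one, gm_xi_right] at h
  apply two_mul_cancel
  linear_combination -h

/-- The covariant derivative `(∇_X φ_α) Y`. -/
def covPhi (α : Fin 3) (X Y : V) : V := nab F V X (ph F V α Y) - ph F V α (nab F V X Y)

theorem nab_ph (α : Fin 3) (X Y : V) :
    nab F V X (ph F V α Y) = covPhi F V α X Y + ph F V α (nab F V X Y) := by
  rw [covPhi, sub_add_cancel]

theorem gm_covPhi_right (α : Fin 3) (X Y Z : V) :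
    gm F V Y (covPhi F V α X Z) = -gm F V (covPhi F V α X Y) Z := by
  have h1 := der_gm F V X (ph F V α Y) Z
  rw [gm_ph, der_neg, der_gm, nab_ph, nab_ph, gm_add_left, gm_add_right, gm_ph, gm_ph] at h1
  linear_combination -h1

theorem covPhi_ph (α : Fin 3) (X Y : V) :
    covPhi F V α X (ph F V α Y) = -ph F V α (covPhi F V α X Y)
      + gm F V (nab F V X (rxi F V α)) Y • rxi F V α + et F V α Y • nab F V X (rxi F V α) := by
  simp only [covPhi, ph_ph, nab_add_right, nab_neg_right, nab_leibniz, der_et, ph_sub]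
  module

theorem et_covPhi (α : Fin 3) (X Y : V) :
    et F V α (covPhi F V α X Y) = -gm F V (nab F V X (rxi F V α)) (ph F V α Y) := by
  have h := der_et F V α X (ph F V α Y)
  rw [et_ph, der_zero] at h
  rw [covPhi, et_sub, et_ph]
  linear_combination -h

theorem two_mul_dOne_et (α : Fin 3) (X Y : V) :
    2 * dOne F V (et F V α) X Y
      = gm F V (nab F V X (rxi F V α)) Y - gm F V (nab F V Y (rxi F V α)) X := by
  have h := two_smul_inv_two (der F V X (et F V α Y) - der F V Y (et F V α X)
    - et F V α (lie F V X Y))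
  rw [Algebra.smul_def, map_ofNat] at h
  rw [dOne, h, der_et, der_et, lie_eq, et_sub]
  ring

theorem two_smul_dOne_et (α : Fin 3) (X Y : V) :
    (2 : ℝ) • dOne F V (et F V α) X Y
      = gm F V (nab F V X (rxi F V α)) Y - gm F V (nab F V Y (rxi F V α)) X := by
  rw [← two_mul_dOne_et, Algebra.smul_def, map_ofNat]

variable {F V}

/-- Closedness of the fundamental 2-form in terms of `∇φ_α`. -/
theorem covPhi_cyclic {α : Fin 3} (hc : IsClosedTwo F V (Phi F V α)) (X Y Z : V) :
    gm F V (covPhi F V α X Y) Z + gm F V (covPhi F V α Y Z) X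
      + gm F V (covPhi F V α Z X) Y = 0 := by
  have h := congrArg ((3 : ℝ) • ·) (hc X Y Z)
  simp only [dTwo, smul_zero, smul_smul, Phi] at h
  rw [mul_inv_cancel₀ (by norm_num), one_smul] at h
  simp only [der_gm, lie_eq, nab_ph, gm_add_right, gm_sub_left, gm_covPhi_right] at h
  have e : ∀ A B : V, gm F V A (ph F V α B) = -gm F V B (ph F V α A) := fun A B => by
    rw [gm_symm, gm_ph]
  rw [e X, e Y, e Z] at h
  linear_combination -h

/-- Normality in terms of `∇φ_α`. -/
theorem normal_covPhi {α : Fin 3} (hn : IsNormal F V α) (X Y : V) :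
    covPhi F V α (ph F V α X) Y - covPhi F V α (ph F V α Y) X
      + ph F V α (covPhi F V α Y X) - ph F V α (covPhi F V α X Y)
      + (gm F V (nab F V X (rxi F V α)) Y - gm F V (nab F V Y (rxi F V α)) X) • rxi F V α
      = 0 := by
  have h := hn X Y
  rw [NOne, two_smul_dOne_et, Nij] at h
  simp only [lie_eq, nab_ph, ph_sub, ph_add] at h
  rw [← h]
  module

/-- `dη_α(ξ_α, ·) = 0`, i.e. `∇_{ξ_α} ξ_α = 0`. -/
theorem nab_xi_xi {α : Fin 3} (hn : IsNormal F V α) :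
    nab F V (rxi F V α) (rxi F V α) = 0 := by
  apply gm_ext (F := F)
  intro X
  have h := congrArg (et F V α) (normal_covPhi hn (rxi F V α) X)
  simp only [et_add, et_sub, et_ph, et_covPhi, et_smul, ph_xi, et_xi, gm_xi_right,
    et_nab_xi, et_zero, gm_zero_right] at h
  have h0 : nab F V (0 : V) (rxi F V α) = 0 := by
    simpa using nab_smul_left F V 0 0 (rxi F V α)
  rw [h0, gm_zero_left] at h
  rw [gm_zero_left]
  linear_combination h

/-- The tensor `N⁽²⁾` of a normal structure vanishes: `dη_α(φ_α X, Y) = -dη_α(X, φ_α Y)`. -/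
theorem dEta_ph {α : Fin 3} (hn : IsNormal F V α) (X Y : V) :
    gm F V (nab F V (ph F V α X) (rxi F V α)) Y - gm F V (nab F V Y (rxi F V α)) (ph F V α X)
      = -(gm F V (nab F V X (rxi F V α)) (ph F V α Y)
        - gm F V (nab F V (ph F V α Y) (rxi F V α)) X) := by
  have h := congrArg (et F V α) (normal_covPhi hn (ph F V α X) Y)
  simp only [et_add, et_sub, et_ph, et_covPhi, et_smul, et_xi, ph_ph, nab_add_left,
    nab_neg_left, nab_smul_left, nab_xi_xi hn, smul_zero, add_zero, gm_neg_left,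
    gm_neg_right, gm_add_right, gm_smul_right, gm_xi_right, et_nab_xi,
    et_zero] at h
  linear_combination h

variable {α : Fin 3}

theorem two_mul_gm_covPhi (hq : IsQuasiSasakian F V α) (X Y Z : V) :
    2 * gm F V (covPhi F V α X Y) Z
      = -et F V α Z * (gm F V (nab F V X (rxi F V α)) (ph F V α Y)
          - gm F V (nab F V (ph F V α Y) (rxi F V α)) X)
        + et F V α Y * (gm F V (nab F V X (rxi F V α)) (ph F V α Z)
          - gm F V (nab F V (ph F V α Z) (rxi F V α)) X) := by
  obtain ⟨hn, hc⟩ := hq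
  have hN := congrArg (gm F V · (ph F V α X)) (normal_covPhi hn Y Z)
  have hC := covPhi_cyclic hc X Y Z
  have hC' := covPhi_cyclic hc X (ph F V α Y) (ph F V α Z)
  have h1 := dEta_ph hn Y Z
  have hr : ∀ A B C : V, gm F V (covPhi F V α A B) (ph F V α C)
      = gm F V (covPhi F V α A (ph F V α B)) C - gm F V (nab F V A (rxi F V α)) B * et F V α C
        - et F V α B * gm F V (nab F V A (rxi F V α)) C := by
    intro A B C
    rw [covPhi_ph, gm_add_left, gm_add_left, gm_neg_left, gm_ph, gm_smul_left, gm_smul_left,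
      gm_xi_left]
    ring
  have hs : ∀ A B C : V, gm F V (covPhi F V α A B) C = -gm F V (covPhi F V α A C) B := by
    intro A B C
    rw [gm_symm, gm_covPhi_right]
  have hx : gm F V (covPhi F V α X (ph F V α Y)) (ph F V α Z)
      = -(gm F V (covPhi F V α X Y) Z + gm F V (nab F V X (rxi F V α)) (ph F V α Y) * et F V α Z)
        + et F V α Y * gm F V (nab F V X (rxi F V α)) (ph F V α Z) := by
    rw [covPhi_ph, gm_add_left, gm_add_left, gm_neg_left, gm_ph, ph_ph, gm_smul_left,
      gm_smul_left, gm_xi_left, et_ph, gm_add_right, gm_neg_right, gm_smul_right, gm_xi_right,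
      et_covPhi]
    ring
  have e1 := hs (ph F V α Z) X (ph F V α Y)
  simp only [gm_add_left, gm_sub_left, gm_smul_left, gm_zero_left, gm_xi_left, et_ph, mul_zero,
    add_zero, hr (ph F V α Y), hr (ph F V α Z), gm_ph F V α (covPhi F V α Z Y),
    gm_ph F V α (covPhi F V α Y Z), ph_ph, gm_add_right, gm_neg_right, gm_smul_right,
    gm_xi_right, et_covPhi] at hN
  linear_combination hN - hC' + hC + hx + e1 - hs Z Y X + et F V α X * h1

/-- The Reeb vector field of a quasi-Sasakian structure is Killing. -/
theorem gm_nab_xi_skew (hq : IsQuasiSasakian F V α) (X Y : V) :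
    gm F V (nab F V X (rxi F V α)) Y = -gm F V (nab F V Y (rxi F V α)) X := by
  have key : gm F V (nab F V X (rxi F V α)) (ph F V α (ph F V α Y))
      = -gm F V (nab F V (ph F V α (ph F V α Y)) (rxi F V α)) X := by
    have h1 := two_mul_gm_covPhi hq X (ph F V α Y) (rxi F V α)
    rw [gm_xi_right, et_covPhi, et_xi, et_ph] at h1
    linear_combination -h1
  rw [ph_ph, nab_add_left, nab_neg_left, nab_smul_left, nab_xi_xi hq.1, gm_add_right,
    gm_neg_right, gm_smul_right, gm_xi_right, et_nab_xi, gm_add_left, gm_neg_left, gm_smul_left,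
    gm_zero_left] at key
  linear_combination -key

theorem covPhi_eq (hq : IsQuasiSasakian F V α) (X Y : V) :
    covPhi F V α X Y = -(gm F V (nab F V X (rxi F V α)) (ph F V α Y) • rxi F V α)
      - et F V α Y • ph F V α (nab F V X (rxi F V α)) := by
  apply gm_ext (F := F)
  intro Z
  apply two_mul_cancel
  rw [two_mul_gm_covPhi hq, gm_nab_xi_skew hq (ph F V α Y), gm_nab_xi_skew hq (ph F V α Z),
    gm_sub_left, gm_neg_left, gm_smul_left, gm_smul_left, gm_xi_left, gm_ph]
  ring

theorem nab_ph_xi (hq : IsQuasiSasakian F V α) (X : V) :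
    nab F V (ph F V α X) (rxi F V α) = ph F V α (nab F V X (rxi F V α)) := by
  apply gm_ext (F := F)
  intro Y
  apply two_mul_cancel
  rw [gm_ph]
  linear_combination dEta_ph hq.1 X Y + gm_nab_xi_skew hq Y (ph F V α X)
    + gm_nab_xi_skew hq X (ph F V α Y)

theorem two_mul_gm_nab_xi (hq : IsQuasiSasakian F V α) (X Y : V) :
    2 * gm F V (nab F V X (rxi F V α)) Y
      = der F V X (et F V α Y) - der F V Y (et F V α X) - et F V α (lie F V X Y) := by
  rw [der_et, der_et, lie_eq, et_sub]
  linear_combination gm_nab_xi_skew hq X Y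

theorem dd_eta (hq : IsQuasiSasakian F V α) (X Y Z : V) :
    der F V X (gm F V (nab F V Y (rxi F V α)) Z) + der F V Y (gm F V (nab F V Z (rxi F V α)) X)
      + der F V Z (gm F V (nab F V X (rxi F V α)) Y)
      - gm F V (nab F V (lie F V X Y) (rxi F V α)) Z
      - gm F V (nab F V (lie F V Y Z) (rxi F V α)) X
      - gm F V (nab F V (lie F V Z X) (rxi F V α)) Y = 0 := by
  have h := dEta_closed α X Y Z _ (two_mul_gm_nab_xi hq)
  simp only [der_two_mul] at h
  apply two_mul_cancel
  linear_combination h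

/-- The covariant derivative of `∇ξ_α` along `ξ_β`. -/
theorem nab_xi_nab_xi (hq : IsQuasiSasakian F V α) {β γ : Fin 3} (hβ : IsQuasiSasakian F V β) (hγ : IsQuasiSasakian F V γ)
    (r : ℝ) (h : nab F V (rxi F V β) (rxi F V α) = algebraMap ℝ F r • rxi F V γ) (X : V) :
    nab F V (rxi F V β) (nab F V X (rxi F V α)) - nab F V (nab F V (rxi F V β) X) (rxi F V α)
      = (2 : F) • algebraMap ℝ F r • nab F V X (rxi F V γ)
        + nab F V (nab F V X (rxi F V α)) (rxi F V β)
        - nab F V (nab F V X (rxi F V β)) (rxi F V α) := by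
  apply gm_ext (F := F)
  intro Y
  have hd := dd_eta hq (rxi F V β) X Y
  have hs : ∀ Z, gm F V (nab F V Z (rxi F V α)) (rxi F V β)
      = -(algebraMap ℝ F r * et F V γ Z) := fun Z => by
    rw [gm_nab_xi_skew hq, h, gm_smul_left, gm_xi_left]
  rw [hs, hs, h] at hd
  simp only [der_gm, der_neg, der_mul, der_algebraMap, der_et, gm_smul_left, gm_xi_left, lie_eq,
    nab_sub_left, gm_sub_left, et_sub] at hd
  simp only [gm_sub_left, gm_add_left, gm_smul_left]
  linear_combination hd - algebraMap ℝ F r * gm_nab_xi_skew hγ Y X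
    - gm_nab_xi_skew hq (nab F V (rxi F V β) Y) X
    + gm_nab_xi_skew hq (nab F V Y (rxi F V β)) X
    - gm_nab_xi_skew hβ (nab F V X (rxi F V α)) Y
    + gm_symm F V (nab F V Y (rxi F V β)) (nab F V X (rxi F V α))

end connection

section horizontal

variable {F V : Type} [CommRing F] [Algebra ℝ F] [AddCommGroup V] [Module F V]
  [SmoothSetting F V] [ACM3 F V]

theorem gm_sum_xi (X W : V) :
    gm F V X (∑ α : Fin 3, et F V α W • rxi F V α) = ∑ α : Fin 3, et F V α W * et F V α X := by
  simp only [Fin.sum_univ_three, gm_add_right, gm_smul_right, gm_xi_right]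

theorem horiz_horComp (X : V) : Horiz F V (horComp F V X) := by
  intro β
  rw [horComp, et_sub, et_eq F V β (∑ α, _), gm_symm, gm_sum_xi, ← gm_xi_left F V β X]
  fin_cases β <;>
    simp [Fin.sum_univ_three, et_xi, et_xi_of_ne, gm_xi_left]

theorem horComp_add (X : V) :
    X = horComp F V X + ∑ α : Fin 3, et F V α X • rxi F V α := by
  rw [horComp, sub_add_cancel]

theorem Horiz.add {X Y : V} (hX : Horiz F V X) (hY : Horiz F V Y) : Horiz F V (X + Y) :=
  fun α => by rw [et_add, hX, hY, add_zero]

theorem Horiz.smul {X : V} (f : F) (hX : Horiz F V X) : Horiz F V (f • X) :=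
  fun α => by rw [et_smul, hX, mul_zero]

theorem Horiz.ext {X Y : V} (hX : Horiz F V X) (hY : Horiz F V Y)
    (h : ∀ W, Horiz F V W → gm F V X W = gm F V Y W) : X = Y := by
  apply gm_ext (F := F)
  intro W
  rw [horComp_add (F := F) W, gm_add_right, gm_add_right, gm_sum_xi, gm_sum_xi,
    h _ (horiz_horComp W)]
  simp only [hX _, hY _]

theorem Horiz.ph {X : V} (hX : Horiz F V X) (α : Fin 3) : Horiz F V (ph F V α X) := by
  intro β
  rcases eq_or_ne α β with rfl | hne
  · exact et_ph F V α X
  · obtain ⟨c, hc | hc⟩ := cyclic_cases hne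
    · rw [et_ph_prev F V hc, hX, neg_zero]
    · rw [et_ph_next F V hc, hX]

theorem Horiz.ph_ph {X : V} (hX : Horiz F V X) (α : Fin 3) :
    QS3.ph F V α (QS3.ph F V α X) = -X := by
  rw [QS3.ph_ph, hX, zero_smul, add_zero]

theorem Horiz.ph_injective {X Y : V} (hX : Horiz F V X) (hY : Horiz F V Y) {α : Fin 3}
    (h : QS3.ph F V α X = QS3.ph F V α Y) : X = Y := by
  rw [← neg_inj, ← hX.ph_ph α, ← hY.ph_ph α, h]

theorem Horiz.ph_ph_next {X : V} (hX : Horiz F V X) {a b c : Fin 3} (h : Cyclic a b c) :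
    QS3.ph F V a (QS3.ph F V b X) = QS3.ph F V c X := by
  rw [ph_eq_ph_ph F V h, hX, zero_smul, sub_zero]

theorem Horiz.ph_ph_prev {X : V} (hX : Horiz F V X) {a b c : Fin 3} (h : Cyclic a b c) :
    QS3.ph F V b (QS3.ph F V a X) = -QS3.ph F V c X := by
  rw [ph_eq_neg_ph_ph F V h, hX, zero_smul, add_zero, neg_neg]

end horizontal

section threeQS

variable {F V : Type} [CommRing F] [Algebra ℝ F] [AddCommGroup V] [Module F V]
  [SmoothSetting F V] [ACM3 F V] [ThreeQS F V]

theorem isQuasiSasakian (α : Fin 3) : IsQuasiSasakian F V α := ThreeQS.qs α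

theorem psiT_add (α : Fin 3) (X Y : V) :
    psiT F V α (X + Y) = psiT F V α X + psiT F V α Y := ThreeQS.psi_add α X Y

theorem psiT_smul (α : Fin 3) (f : F) (X : V) :
    psiT F V α (f • X) = f • psiT F V α X := ThreeQS.psi_smul α f X

theorem psiT_zero (α : Fin 3) : psiT F V α 0 = 0 := by
  simpa using psiT_smul (F := F) (V := V) α 0 0

theorem smul_psiT_psiT_xi (α β : Fin 3) :
    algebraMap ℝ F (cc F V / 2) • psiT F V α (psiT F V α (rxi F V β))
      = algebraMap ℝ F (cc F V / 2) • ph F V α (ph F V α (rxi F V β)) := by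
  by_cases h0 : cc F V = 0
  · rw [h0, zero_div, map_zero, zero_smul, zero_smul]
  · have hv : ∀ γ, psiT F V α (rxi F V γ) = ph F V α (rxi F V γ) :=
      ThreeQS.psi_vert_of_ne h0 α
    congr 1
    rw [hv]
    rcases eq_or_ne α β with rfl | hne
    · rw [ph_xi, psiT_zero, ph_zero]
    · obtain ⟨c, hc | hc⟩ := cyclic_cases hne
      · rw [ph_xi_next F V hc, hv]
      · rw [ph_xi_prev F V hc, ← neg_one_smul F, psiT_smul, ph_smul, hv]

variable [LeviCivita F V]

theorem nab_xi_anticomm {a b : Fin 3} (hab : a ≠ b) :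
    nab F V (rxi F V a) (rxi F V b) = -nab F V (rxi F V b) (rxi F V a) := by
  apply gm_ext (F := F)
  intro X
  have h := der_gm F V X (rxi F V a) (rxi F V b)
  rw [gm_xi_right, et_xi_of_ne F V hab.symm, der_zero, gm_symm F V (rxi F V a),
    gm_nab_xi_skew (isQuasiSasakian a), gm_nab_xi_skew (isQuasiSasakian b)] at h
  rw [gm_neg_left]
  linear_combination h

theorem nab_xi_next {a b c : Fin 3} (h : Cyclic a b c) :
    nab F V (rxi F V a) (rxi F V b) = algebraMap ℝ F (cc F V / 2) • rxi F V c := by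
  have h1 : lie F V (rxi F V a) (rxi F V b) = algebraMap ℝ F (cc F V) • rxi F V c :=
    ThreeQS.reeb_bracket a b c h
  rw [lie_eq, nab_xi_anticomm h.ne.symm, sub_neg_eq_add, ← two_smul F] at h1
  apply two_smul_cancel (F := F)
  rw [h1, smul_smul, ← map_ofNat (algebraMap ℝ F) 2, ← map_mul, mul_div_cancel₀ _ two_ne_zero]

theorem nab_xi_prev {a b c : Fin 3} (h : Cyclic a b c) :
    nab F V (rxi F V b) (rxi F V a) = algebraMap ℝ F (-(cc F V / 2)) • rxi F V c := by
  rw [nab_xi_anticomm h.ne.symm, nab_xi_next h, map_neg, neg_smul]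

theorem exists_nab_xi (a b : Fin 3) :
    ∃ (f : F) (c : Fin 3), nab F V (rxi F V a) (rxi F V b) = f • rxi F V c := by
  rcases eq_or_ne a b with rfl | hne
  · exact ⟨0, a, by rw [nab_xi_xi (isQuasiSasakian a).1, zero_smul]⟩
  · obtain ⟨c, hc | hc⟩ := cyclic_cases hne
    · exact ⟨_, c, nab_xi_next hc⟩
    · exact ⟨_, c, nab_xi_prev hc⟩

/-- On vertical fields, `∇ξ_α = -(c/2) φ_α`. -/
theorem nab_xi_eq_neg_ph (a b : Fin 3) :
    nab F V (rxi F V b) (rxi F V a)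
      = -(algebraMap ℝ F (cc F V / 2) • ph F V a (rxi F V b)) := by
  rcases eq_or_ne a b with rfl | hne
  · rw [nab_xi_xi (isQuasiSasakian a).1, ph_xi, smul_zero, neg_zero]
  · obtain ⟨c, hc | hc⟩ := cyclic_cases hne
    · rw [nab_xi_prev hc, ph_xi_next F V hc, map_neg, neg_smul]
    · rw [nab_xi_next hc, ph_xi_prev F V hc, smul_neg, neg_neg]

theorem Horiz.gm_nab_xi {X : V} (hX : Horiz F V X) (a b : Fin 3) :
    gm F V (nab F V (rxi F V b) (rxi F V a)) X = 0 := by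
  obtain ⟨f, c, h⟩ := exists_nab_xi (F := F) (V := V) b a
  rw [h, gm_smul_left, gm_xi_left, hX, mul_zero]

theorem Horiz.nab_xi {X : V} (hX : Horiz F V X) (α : Fin 3) :
    Horiz F V (nab F V X (rxi F V α)) := by
  intro β
  rw [et_eq, gm_nab_xi_skew (isQuasiSasakian α), hX.gm_nab_xi, neg_zero]

theorem Horiz.nab {X : V} (hX : Horiz F V X) (β : Fin 3) :
    Horiz F V (QS3.nab F V (rxi F V β) X) := by
  intro γ
  have h := der_et F V γ (rxi F V β) X
  rw [hX, der_zero, hX.gm_nab_xi, add_zero] at h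
  exact h.symm

theorem Horiz.covPhi_xi {X : V} (hX : Horiz F V X) (α β : Fin 3) :
    covPhi F V α (rxi F V β) X = 0 := by
  rw [covPhi_eq (isQuasiSasakian α), (hX.ph α).gm_nab_xi, hX, zero_smul, zero_smul, neg_zero,
    sub_zero]

theorem Horiz.nab_xi_ph {X : V} (hX : Horiz F V X) (α β : Fin 3) :
    QS3.nab F V (rxi F V β) (QS3.ph F V α X) = QS3.ph F V α (QS3.nab F V (rxi F V β) X) := by
  rw [nab_ph, hX.covPhi_xi, zero_add]

theorem Horiz.ph_nab_xi_eq_next {X : V} (hX : Horiz F V X) {a b c : Fin 3} (h : Cyclic a b c) :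
    QS3.ph F V a (QS3.nab F V X (rxi F V a)) = QS3.ph F V b (QS3.nab F V X (rxi F V b)) := by
  have key : ∀ W, Horiz F V W → gm F V (QS3.nab F V X (rxi F V a)) (QS3.ph F V c W)
      = -gm F V (QS3.nab F V X (rxi F V b)) W := by
    intro W hW
    have h1 := der_et F V a X (QS3.ph F V c W)
    have h2 := der_et F V b X W
    rw [hW, der_zero] at h2
    rw [hW.ph c, der_zero, nab_ph, covPhi_eq (isQuasiSasakian c), hW, zero_smul, sub_zero,
      et_add, et_neg, et_smul, et_ph_prev F V h.rotate.rotate,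
      et_xi_of_ne F V h.rotate.rotate.ne.symm] at h1
    linear_combination -h1 - h2
  refine Horiz.ext (F := F) ((hX.nab_xi a).ph a) ((hX.nab_xi b).ph b) fun W hW => ?_
  have h1 := key _ (hW.ph b)
  rw [hW.ph_ph_prev h.rotate, gm_neg_right] at h1
  rw [gm_ph, gm_ph]
  linear_combination h1

/-- The operator `S = φ_α ∘ ∇ξ_α` on horizontal fields satisfies `S² = (c/2) S`. -/
theorem Horiz.ph_nab_xi_sq {X : V} (hX : Horiz F V X) (a : Fin 3) :
    QS3.ph F V a (QS3.nab F V (QS3.ph F V a (QS3.nab F V X (rxi F V a))) (rxi F V a))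
      = algebraMap ℝ F (cc F V / 2) • QS3.ph F V a (QS3.nab F V X (rxi F V a)) := by
  obtain ⟨b, c, h⟩ := exists_cyclic a
  have hab : ∀ {Y : V}, Horiz F V Y → QS3.ph F V a (QS3.nab F V Y (rxi F V a))
      = QS3.ph F V b (QS3.nab F V Y (rxi F V b)) := fun hY => hY.ph_nab_xi_eq_next h
  have hbc : ∀ {Y : V}, Horiz F V Y → QS3.ph F V b (QS3.nab F V Y (rxi F V b))
      = QS3.ph F V c (QS3.nab F V Y (rxi F V c)) := fun hY => hY.ph_nab_xi_eq_next h.rotate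
  set S : V → V := fun Y => QS3.ph F V a (QS3.nab F V Y (rxi F V a)) with hS
  have hSh : ∀ {Y : V}, Horiz F V Y → Horiz F V (S Y) := fun hY => (hY.nab_xi a).ph a
  have ha : ∀ {Y : V}, Horiz F V Y → QS3.nab F V Y (rxi F V a) = -QS3.ph F V a (S Y) :=
    fun hY => by rw [hS, (hY.nab_xi a).ph_ph, neg_neg]
  have hb : ∀ {Y : V}, Horiz F V Y → QS3.nab F V Y (rxi F V b) = -QS3.ph F V b (S Y) :=
    fun hY => by rw [hS]; dsimp only; rw [hab hY, (hY.nab_xi b).ph_ph, neg_neg]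
  have hc : ∀ {Y : V}, Horiz F V Y → QS3.nab F V Y (rxi F V c) = -QS3.ph F V c (S Y) :=
    fun hY => by rw [hS]; dsimp only; rw [hab hY, hbc hY, (hY.nab_xi c).ph_ph, neg_neg]
  have hSb : ∀ {Y : V}, Horiz F V Y → S (QS3.ph F V b Y) = QS3.ph F V b (S Y) := fun hY => by
    rw [hS]; dsimp only
    rw [hab (hY.ph b), hab hY, nab_ph_xi (isQuasiSasakian b)]
  have hSa : ∀ Y : V, S (QS3.ph F V a Y) = QS3.ph F V a (S Y) := fun Y => by
    rw [hS]; dsimp only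
    rw [nab_ph_xi (isQuasiSasakian a)]
  have hpar : QS3.nab F V (rxi F V b) (QS3.nab F V X (rxi F V a))
      = QS3.nab F V (QS3.nab F V (rxi F V b) X) (rxi F V a) := by
    have hbb := nab_xi_nab_xi (isQuasiSasakian b) (isQuasiSasakian b) (isQuasiSasakian b) 0
      (by rw [nab_xi_xi (F := F) (V := V) (isQuasiSasakian b).1, map_zero, zero_smul]) X
    rw [map_zero, zero_smul, smul_zero, zero_add, sub_self, sub_eq_zero] at hbb
    rw [ha hX, ha (hX.nab b), hS]
    dsimp only
    rw [hab hX, hab (hX.nab b), nab_neg_right, ((hX.nab_xi b).ph b).nab_xi_ph,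
      (hX.nab_xi b).nab_xi_ph, hbb]
  have hmain := nab_xi_nab_xi (F := F) (V := V) (isQuasiSasakian a) (isQuasiSasakian b) (isQuasiSasakian c) _
    (nab_xi_prev h) X
  rw [hpar, sub_self, hc hX, hb (hX.nab_xi a), ha (hX.nab_xi b), ha hX, hb hX] at hmain
  have hneg : ∀ Y : V, S (-Y) = -S Y := fun Y => by
    rw [hS]; dsimp only
    rw [nab_neg_left, ph_neg]
  rw [hneg, hneg, hSa, hSb (hSh hX), ph_neg, ph_neg, (hSh (hSh hX)).ph_ph_prev h,
    (hSh (hSh hX)).ph_ph_next h, map_neg] at hmain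
  refine Horiz.ph_injective (α := c) (hSh (hSh hX)) ((hSh hX).smul _) ?_
  apply two_smul_cancel (F := F)
  rw [ph_smul]
  linear_combination (norm := module) hmain

theorem nab_xi_of_inE4m {X : V} (hX : InE4m F V X) (α : Fin 3) :
    nab F V X (rxi F V α) = 0 := by
  apply gm_ext (F := F)
  intro Y
  have h := two_mul_dOne_et F V α X Y
  rw [hX.2, gm_nab_xi_skew (isQuasiSasakian α) Y] at h
  apply two_mul_cancel
  rw [gm_zero_left]
  linear_combination -h

theorem Horiz.inE4m_of_ph_nab_xi {X : V} (hX : Horiz F V X) {a : Fin 3}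
    (h : QS3.ph F V a (QS3.nab F V X (rxi F V a)) = 0) : InE4m F V X := by
  have key : ∀ {b : Fin 3}, QS3.ph F V b (QS3.nab F V X (rxi F V b)) = 0 →
      ∀ Y : V, dOne F V (et F V b) X Y = 0 := by
    intro b hb Y
    have h0 : QS3.nab F V X (rxi F V b) = 0 := by
      have := (hX.nab_xi b).ph_ph b
      rwa [hb, ph_zero, eq_comm, neg_eq_zero] at this
    apply two_mul_cancel
    rw [two_mul_dOne_et, gm_nab_xi_skew (isQuasiSasakian b) Y, h0, gm_zero_left]
    ring
  refine ⟨hX, fun b => ?_⟩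
  rcases eq_or_ne a b with rfl | hne
  · exact key h
  · obtain ⟨c, hc | hc⟩ := cyclic_cases hne
    · exact key (by rw [← hX.ph_nab_xi_eq_next hc, h])
    · exact key (by rw [hX.ph_nab_xi_eq_next hc, h])

theorem ph_nab_xi_of_inE4l {X : V} (hX : InE4l F V X) (α : Fin 3) :
    ph F V α (nab F V X (rxi F V α)) = algebraMap ℝ F (cc F V / 2) • X := by
  have hS := (hX.1.nab_xi α).ph α
  have hk := hX.1.smul (algebraMap ℝ F (cc F V / 2))
  have hm : InE4m F V (ph F V α (nab F V X (rxi F V α))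
      + (-algebraMap ℝ F (cc F V / 2)) • X) := by
    refine (hS.add (hX.1.smul _)).inE4m_of_ph_nab_xi (a := α) ?_
    rw [nab_add_left, nab_smul_left, ph_add, ph_smul, hX.1.ph_nab_xi_sq]
    module
  refine Horiz.ext (F := F) hS hk fun W hW => ?_
  obtain ⟨Y, Z, hY, hZ, rfl⟩ := ThreeQS.horiz_split (F := F) W hW
  have h1 := hY.2 _ hm
  have h2 : gm F V (ph F V α (nab F V X (rxi F V α))) Z = 0 := by
    rw [gm_ph, gm_nab_xi_skew (isQuasiSasakian α), nab_ph_xi (isQuasiSasakian α),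
      nab_xi_of_inE4m hZ, ph_zero, gm_zero_left, neg_zero, neg_zero]
  have h3 := hX.2 Z hZ
  rw [gm_symm, gm_add_left, gm_smul_left] at h1
  rw [gm_add_right, gm_add_right, gm_smul_left, gm_smul_left, h2, h3]
  linear_combination h1

/-- `φ_α ∇_X ξ_α = -(c/2) ψ_α² X`. -/
theorem ph_nab_xi (α : Fin 3) (X : V) :
    ph F V α (nab F V X (rxi F V α))
      = -(algebraMap ℝ F (cc F V / 2) • psiT F V α (psiT F V α X)) := by
  have hxi : ∀ β, ph F V α (nab F V (rxi F V β) (rxi F V α))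
      = -(algebraMap ℝ F (cc F V / 2) • psiT F V α (psiT F V α (rxi F V β))) := fun β => by
    rw [smul_psiT_psiT_xi, nab_xi_eq_neg_ph, ph_neg, ph_smul]
  obtain ⟨Y, Z, hY, hZ, hYZ⟩ := ThreeQS.horiz_split (F := F) _ (horiz_horComp (F := F) X)
  have hpY : psiT F V α (psiT F V α Y) = -Y := by
    rw [show psiT F V α Y = ph F V α Y from ThreeQS.psi_E4l α Y hY,
      show psiT F V α (ph F V α Y) = ph F V α (ph F V α Y) from
        ThreeQS.psi_E4l α _ (ThreeQS.phi_E4l α Y hY), hY.1.ph_ph]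
  have hpZ : psiT F V α Z = 0 := ThreeQS.psi_E4m α Z hZ
  rw [horComp_add (F := F) X, hYZ]
  simp only [Fin.sum_univ_three, nab_add_left, nab_smul_left, ph_add, ph_smul, psiT_add,
    psiT_smul, hxi, ph_nab_xi_of_inE4l hY, nab_xi_of_inE4m hZ, ph_zero, hpY, hpZ, psiT_zero]
  module

end threeQS

/-- In any 3-quasi-Sasakian manifold,
`(∇_X φ_α)Y = (c/2)(η_α(Y) ψ_α² X - g(ψ_α² X, Y) ξ_α)`; consequently, for
`α ≠ β`, `(∇_{ξ_β} φ_α)X = (c/2)(η_β(X) ξ_α - η_α(X) ξ_β)`. -/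
theorem nabla_phi_eq (F V : Type) [CommRing F] [Algebra ℝ F] [AddCommGroup V] [Module F V]
    [SmoothSetting F V] [ACM3 F V] [ThreeQS F V] [LeviCivita F V] :
    (∀ (α : Fin 3) (X Y : V),
      nab F V X (ph F V α Y) - ph F V α (nab F V X Y)
        = algebraMap ℝ F (cc F V / 2) •
            (et F V α Y • psiT F V α (psiT F V α X)
              - gm F V (psiT F V α (psiT F V α X)) Y • rxi F V α)) ∧
    (∀ α β : Fin 3, α ≠ β → ∀ X : V,
      nab F V (rxi F V β) (ph F V α X) - ph F V α (nab F V (rxi F V β) X)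
        = algebraMap ℝ F (cc F V / 2) •
            (et F V β X • rxi F V α - et F V α X • rxi F V β)) := by
  refine ⟨fun α X Y => ?_, fun α β h X => ?_⟩
  · change covPhi F V α X Y = _
    rw [covPhi_eq (isQuasiSasakian α), ← neg_neg (gm F V _ (ph F V α Y)), ← gm_ph, ph_nab_xi,
      gm_neg_left, gm_smul_left]
    module
  · change covPhi F V α (rxi F V β) X = _
    have hβ : ph F V α (ph F V α (rxi F V β)) = -rxi F V β := by
      rw [ph_ph, et_xi_of_ne F V h, zero_smul, add_zero]
    rw [covPhi_eq (isQuasiSasakian α), ← neg_neg (gm F V _ (ph F V α X)), ← gm_ph,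
      nab_xi_eq_neg_ph, ph_neg, ph_smul, hβ, gm_neg_left, gm_smul_left, gm_neg_left, gm_xi_left]
    module

end QS3
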